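/- Let A be a linear map and C a nonempty closed convex set with 0 ∉ C and A⁻¹C ≠ ∅. Then (A⁻¹C)′ = cl(A*C′), both sets being nonempty. -/

import Mathlib

open scoped RealInnerProductSpace

/-- The antipolar `S′ = {y : ⟨y,s⟩ ≥ 1 for all s ∈ S}`. -/
def antipolar {E : Type*} [NormedAddCommGroup E] [InnerProductSpace ℝ E] (S : Set E) :
    Set E :=
  {y : E | ∀ x ∈ S, 1 ≤ ⟪y, x⟫}

/-- If the segment `[0, z]` misses a closed convex set `C`, then some element of the antipolar
of `C` separates `z` from `C`. -/
theorem exists_mem_antipolar_inner_lt_one {F : Type*} [NormedAddCommGroup F]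
    [InnerProductSpace ℝ F] [FiniteDimensional ℝ F] {C : Set F} (hclosed : IsClosed C)
    (hconv : Convex ℝ C) {z : F} (hz : Disjoint (segment ℝ 0 z) C) :
    ∃ u ∈ antipolar C, ⟪u, z⟫ < 1 := by
  have hcompact : IsCompact (segment ℝ 0 z) := by
    rw [segment_eq_image]
    exact isCompact_Icc.image (by fun_prop)
  obtain ⟨f, a, b, hfa, hab, hbf⟩ :=
    geometric_hahn_banach_compact_closed (convex_segment 0 z) hcompact hconv hclosed hz
  have ha : 0 < a := by simpa using hfa 0 (left_mem_segment ℝ 0 z)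
  have hb : 0 < b := ha.trans hab
  have hinner (x : F) : ⟪b⁻¹ • (InnerProductSpace.toDual ℝ F).symm f, x⟫ = f x / b := by
    rw [real_inner_smul_left, InnerProductSpace.toDual_symm_apply, inv_mul_eq_div]
  refine ⟨b⁻¹ • (InnerProductSpace.toDual ℝ F).symm f, fun c hc => ?_, ?_⟩
  · rw [hinner, one_le_div hb]
    exact (hbf c hc).le
  · rw [hinner, div_lt_one hb]
    exact (hfa z (right_mem_segment ℝ 0 z)).trans hab

theorem antipolar_nonempty {F : Type*} [NormedAddCommGroup F]
    [InnerProductSpace ℝ F] [FiniteDimensional ℝ F] {C : Set F} (hclosed : IsClosed C)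
    (hconv : Convex ℝ C) (h0 : (0 : F) ∉ C) : (antipolar C).Nonempty := by
  obtain ⟨u, hu, -⟩ := exists_mem_antipolar_inner_lt_one hclosed hconv (z := 0) (by simpa using h0)
  exact ⟨u, hu⟩

/-- Every element of the bi-antipolar of a closed convex set avoiding the origin can be shrunk
into the set. -/
theorem exists_smul_mem_of_mem_antipolar_antipolar {F : Type*} [NormedAddCommGroup F]
    [InnerProductSpace ℝ F] [FiniteDimensional ℝ F] {C : Set F} (hclosed : IsClosed C)
    (hconv : Convex ℝ C) (h0 : (0 : F) ∉ C) {z : F} (hz : z ∈ antipolar (antipolar C)) :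
    ∃ s : ℝ, 0 < s ∧ s ≤ 1 ∧ s • z ∈ C := by
  by_contra! h
  have hdisj : Disjoint (segment ℝ 0 z) C := by
    rw [segment_eq_image, Set.disjoint_left]
    rintro _ ⟨s, ⟨hs0, hs1⟩, rfl⟩ hs
    rcases hs0.eq_or_lt with rfl | hs0
    · exact h0 (by simpa using hs)
    · exact h s hs0 hs1 (by simpa using hs)
  obtain ⟨u, hu, huz⟩ := exists_mem_antipolar_inner_lt_one hclosed hconv hdisj
  have := hz u hu
  rw [real_inner_comm] at this
  linarith

theorem isClosed_antipolar {E : Type*} [NormedAddCommGroup E] [InnerProductSpace ℝ E]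
    (S : Set E) : IsClosed (antipolar S) := by
  simp only [antipolar, Set.ofPred_forall]
  exact isClosed_biInter fun x _ => isClosed_le continuous_const (by fun_prop)

theorem convex_antipolar {E : Type*} [NormedAddCommGroup E] [InnerProductSpace ℝ E]
    (S : Set E) : Convex ℝ (antipolar S) := by
  intro u hu v hv a b ha hb hab x hx
  rw [inner_add_left, real_inner_smul_left, real_inner_smul_left]
  nlinarith [hu x hx, hv x hx]

theorem smul_mem_antipolar {E : Type*} [NormedAddCommGroup E] [InnerProductSpace ℝ E]
    {S : Set E} {u : E} (hu : u ∈ antipolar S) {t : ℝ} (ht : 1 ≤ t) : t • u ∈ antipolar S := by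
  intro x hx
  rw [real_inner_smul_left]
  nlinarith [hu x hx]

/-- A point outside a closed convex set `K` that is stable under scaling by
factors at least one and has nonempty antipolar is separated from `K` by an element of its
antipolar. -/
theorem exists_mem_antipolar_inner_lt_one_of_notMem {E : Type*} [NormedAddCommGroup E]
    [InnerProductSpace ℝ E] [FiniteDimensional ℝ E] {K : Set E} (hclosed : IsClosed K)
    (hconv : Convex ℝ K) (hray : ∀ k ∈ K, ∀ t : ℝ, 1 ≤ t → t • k ∈ K)
    (hne : (antipolar K).Nonempty) {y : E} (hy : y ∉ K) :
    ∃ x ∈ antipolar K, ⟪x, y⟫ < 1 := by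
  obtain ⟨f, γ, hfy, hfK⟩ := geometric_hahn_banach_point_closed hconv hclosed hy
  set x := (InnerProductSpace.toDual ℝ E).symm f
  have hx (v : E) : ⟪x, v⟫ = f v := InnerProductSpace.toDual_symm_apply
  rcases lt_or_ge 0 γ with hγ | hγ
  · refine ⟨γ⁻¹ • x, fun k hk => ?_, ?_⟩
    · rw [real_inner_smul_left, hx, inv_mul_eq_div, one_le_div hγ]
      exact (hfK k hk).le
    · rw [real_inner_smul_left, hx, inv_mul_eq_div, div_lt_one hγ]
      exact hfy
  · have hpos (k : E) (hk : k ∈ K) : 0 ≤ f k := by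
      by_contra! hneg
      have h := hfK _ (hray k hk (max 1 (γ / f k)) (le_max_left _ _))
      rw [map_smul, smul_eq_mul] at h
      have h' := mul_le_mul_of_nonpos_right (le_max_right 1 (γ / f k)) hneg.le
      rw [div_mul_cancel₀ _ hneg.ne] at h'
      linarith
    obtain ⟨w, hw⟩ := hne
    have hneg : 0 < -f y := by linarith
    refine ⟨w + (|⟪w, y⟫| / -f y) • x, fun k hk => ?_, ?_⟩
    · rw [inner_add_left, real_inner_smul_left, hx]
      have := mul_nonneg (div_nonneg (abs_nonneg ⟪w, y⟫) hneg.le) (hpos k hk)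
      linarith [hw k hk]
    · rw [inner_add_left, real_inner_smul_left, hx]
      have : |⟪w, y⟫| / -f y * f y = -|⟪w, y⟫| := by
        rw [div_neg, neg_mul, div_mul_cancel₀ _ (neg_pos.mp hneg).ne]
      linarith [le_abs_self ⟪w, y⟫]

/-- `(A⁻¹C)′ = cl(A* C′)`, where `B = A*` is the adjoint of the linear map `A`. -/
theorem antipolar_preimage {E F : Type*} [NormedAddCommGroup E] [InnerProductSpace ℝ E]
    [FiniteDimensional ℝ E] [NormedAddCommGroup F] [InnerProductSpace ℝ F]
    [FiniteDimensional ℝ F] (A : E →L[ℝ] F) (B : F →L[ℝ] E)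
    (hadj : ∀ (x : E) (y : F), ⟪A x, y⟫ = ⟪x, B y⟫) (C : Set F) (hne : C.Nonempty)
    (hclosed : IsClosed C) (hconv : Convex ℝ C) (h0 : (0 : F) ∉ C)
    (hpre : (A ⁻¹' C).Nonempty) :
    antipolar (A ⁻¹' C) = closure (B '' antipolar C) ∧
    (antipolar (A ⁻¹' C)).Nonempty ∧ (closure (B '' antipolar C)).Nonempty := by
  have hinner (u : F) (x : E) : ⟪B u, x⟫ = ⟪u, A x⟫ := by
    rw [real_inner_comm, ← hadj, real_inner_comm]
  have hsub : closure (B '' antipolar C) ⊆ antipolar (A ⁻¹' C) := by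
    refine closure_minimal ?_ (isClosed_antipolar _)
    rintro _ ⟨u, hu, rfl⟩ x hx
    rw [hinner]
    exact hu _ hx
  have hnonempty : (closure (B '' antipolar C)).Nonempty :=
    ((antipolar_nonempty hclosed hconv h0).image B).closure
  refine ⟨hsub.antisymm' fun y hy => ?_, hnonempty.mono hsub, hnonempty⟩
  by_contra hyK
  have hray : ∀ k ∈ closure (B '' antipolar C), ∀ t : ℝ, 1 ≤ t →
      t • k ∈ closure (B '' antipolar C) := by
    intro k hk t ht
    refine map_mem_closure (continuous_const_smul t) hk ?_
    rintro _ ⟨u, hu, rfl⟩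
    exact ⟨t • u, smul_mem_antipolar hu ht, map_smul B t u⟩
  have hconvK : Convex ℝ (closure (B '' antipolar C)) :=
    ((convex_antipolar C).linear_image B.toLinearMap).closure
  have hneK : (antipolar (closure (B '' antipolar C))).Nonempty := by
    obtain ⟨x, hx⟩ := hpre
    refine ⟨x, fun k hk => ?_⟩
    rw [real_inner_comm]
    exact hsub hk x hx
  obtain ⟨x, hx, hxy⟩ :=
    exists_mem_antipolar_inner_lt_one_of_notMem isClosed_closure hconvK hray hneK hyK
  have hAx : A x ∈ antipolar (antipolar C) := by
    intro u hu
    rw [hadj]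
    exact hx _ (subset_closure ⟨u, hu, rfl⟩)
  obtain ⟨s, hs0, hs1, hs⟩ := exists_smul_mem_of_mem_antipolar_antipolar hclosed hconv h0 hAx
  have h := hy (s • x) (by simpa using hs)
  rw [real_inner_smul_right, real_inner_comm] at h
  nlinarith
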